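/- arXiv:math/0605012 — 2 statements merged into one kernel-verified Lean document; each statement's English description precedes it below -/
import Mathlib

section
/- Let Γ'_ℝ = Γ' ∩ SL(2,ℝ), acting on the upper half-plane ℍ by Möbius transformations. The set F_ℝ = {z ∈ ℍ : 0 ≤ Re z ≤ 2 and (Re z − 1)² + (Im z)² ≥ 2} is an exact fundamental domain for this action: ℍ = ⋃_{γ ∈ Γ'_ℝ} γ·F_ℝ, and whenever γ₁, γ₂ ∈ Γ'_ℝ with γ₁ ≠ γ₂ and γ₁ ≠ −γ₂, one has γ₁·F_ℝ ∩ γ₂·F_ℝ ⊆ γ₁·(∂F_ℝ) ∩ γ₂·(∂F_ℝ), where ∂F_ℝ denotes the topological frontier of F_ℝ in ℍ. -/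
open Complex Matrix

noncomputable section

/-- `z ∈ ℤ[i] ⊆ ℂ`. -/
def IsGauss (z : ℂ) : Prop := ∃ a b : ℤ, z = (a : ℂ) + (b : ℂ) * Complex.I

/-- The matrix of the conjugation action of `g ∈ SL(2,ℂ)` on `sl₂(ℂ)` in the trace-form
orthonormal basis. -/
def CMat (g : Matrix (Fin 2) (Fin 2) ℂ) : Matrix (Fin 3) (Fin 3) ℂ :=
  !![(g 0 0 ^ 2 - g 1 0 ^ 2 + g 1 1 ^ 2 - g 0 1 ^ 2) / 2,
     Complex.I * (g 0 0 ^ 2 - g 1 0 ^ 2 + g 0 1 ^ 2 - g 1 1 ^ 2) / 2,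
     g 1 0 * g 1 1 - g 0 0 * g 0 1;
     Complex.I * (g 0 1 ^ 2 + g 1 1 ^ 2 - g 0 0 ^ 2 - g 1 0 ^ 2) / 2,
     (g 0 0 ^ 2 + g 1 0 ^ 2 + g 0 1 ^ 2 + g 1 1 ^ 2) / 2,
     Complex.I * (g 0 0 * g 0 1 + g 1 0 * g 1 1);
     -(g 0 0 * g 1 0) + g 0 1 * g 1 1,
     Complex.I * (g 0 0 * g 1 0 + g 0 1 * g 1 1),
     g 0 0 * g 1 1 + g 0 1 * g 1 0]

/-- `Γ'_ℝ = Γ' ∩ SL(2,ℝ)`: real matrices of determinant `1` whose image under `C` has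
Gaussian-integer entries. -/
def GammaR : Set (Matrix (Fin 2) (Fin 2) ℂ) :=
  {g | g.det = 1 ∧ (∀ i j, (g i j).im = 0) ∧ ∀ i j, IsGauss (CMat g i j)}

/-- Möbius action of a `2×2` matrix on the upper half-plane `ℍ ⊆ ℂ`. -/
def moeb (g : Matrix (Fin 2) (Fin 2) ℂ) (z : ℂ) : ℂ :=
  (g 0 0 * z + g 0 1) / (g 1 0 * z + g 1 1)

/-- `F_ℝ = {z ∈ ℍ : 0 ≤ Re z ≤ 2, (Re z − 1)² + (Im z)² ≥ 2}`. -/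
def FR : Set ℂ :=
  {z | 0 < z.im ∧ 0 ≤ z.re ∧ z.re ≤ 2 ∧ (z.re - 1) ^ 2 + z.im ^ 2 ≥ 2}

lemma IsGauss.add {z w : ℂ} (hz : IsGauss z) (hw : IsGauss w) : IsGauss (z + w) := by
  obtain ⟨a, b, rfl⟩ := hz
  obtain ⟨c, d, rfl⟩ := hw
  exact ⟨a + c, b + d, by push_cast; ring⟩

lemma IsGauss.mul {z w : ℂ} (hz : IsGauss z) (hw : IsGauss w) : IsGauss (z * w) := by
  obtain ⟨a, b, rfl⟩ := hz
  obtain ⟨c, d, rfl⟩ := hw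
  exact ⟨a * c - b * d, a * d + b * c, by push_cast; linear_combination (b * d : ℂ) * I_sq⟩

lemma IsGauss.exists_int_of_real {r : ℝ} (h : IsGauss r) : ∃ n : ℤ, r = n := by
  obtain ⟨a, b, h⟩ := h
  exact ⟨a, by simpa using congrArg Complex.re h⟩

lemma IsGauss.exists_int_of_I_mul_real {r : ℝ} (h : IsGauss (I * r)) : ∃ n : ℤ, r = n := by
  obtain ⟨a, b, h⟩ := h
  exact ⟨b, by simpa using congrArg Complex.im h⟩

lemma isGauss_intCast (n : ℤ) : IsGauss n := ⟨n, 0, by simp⟩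

lemma isGauss_I_mul_intCast (n : ℤ) : IsGauss (I * n) := ⟨0, n, by push_cast; ring⟩

lemma IsGauss.neg {z : ℂ} (hz : IsGauss z) : IsGauss (-z) := by
  obtain ⟨a, b, rfl⟩ := hz
  exact ⟨-a, -b, by push_cast; ring⟩

/-- The matrix of `X ↦ g X adj(g)` on trace-zero matrices; it agrees with `CMat g` up to the sign
of the entry `(2, 1)`. -/
def adjointMat (g : Matrix (Fin 2) (Fin 2) ℂ) : Matrix (Fin 3) (Fin 3) ℂ :=
  Matrix.of fun i j ↦ if i = 2 ∧ j = 1 then -CMat g i j else CMat g i j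

lemma isGauss_adjointMat_iff (g : Matrix (Fin 2) (Fin 2) ℂ) (i j : Fin 3) :
    IsGauss (adjointMat g i j) ↔ IsGauss (CMat g i j) := by
  simp only [adjointMat, Matrix.of_apply]
  split_ifs
  · exact ⟨fun h ↦ by simpa using h.neg, IsGauss.neg⟩
  · rfl

lemma adjointMat_mul (g h : Matrix (Fin 2) (Fin 2) ℂ) :
    adjointMat (g * h) = adjointMat g * adjointMat h := by
  ext i j
  rw [Matrix.mul_apply, Fin.sum_univ_three]
  fin_cases i <;> fin_cases j <;>
    simp [adjointMat, CMat, Matrix.mul_apply, Fin.sum_univ_two] <;> ring_nf <;>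
    try { simp only [I_sq]; ring }

lemma adjointMat_adjugate (g : Matrix (Fin 2) (Fin 2) ℂ) :
    adjointMat g.adjugate = (adjointMat g).transpose := by
  ext i j
  fin_cases i <;> fin_cases j <;>
    simp [adjointMat, CMat, Matrix.adjugate_fin_two] <;> ring

lemma GammaR.mul_mem {g h : Matrix (Fin 2) (Fin 2) ℂ} (hg : g ∈ GammaR) (hh : h ∈ GammaR) :
    g * h ∈ GammaR := by
  have hg' := fun i j ↦ (isGauss_adjointMat_iff g i j).2 (hg.2.2 i j)
  have hh' := fun i j ↦ (isGauss_adjointMat_iff h i j).2 (hh.2.2 i j)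
  refine ⟨by rw [Matrix.det_mul, hg.1, hh.1, one_mul], fun i j ↦ ?_, fun i j ↦ ?_⟩
  · simp [Matrix.mul_apply, hg.2.1, hh.2.1]
  · rw [← isGauss_adjointMat_iff, adjointMat_mul, Matrix.mul_apply, Fin.sum_univ_three]
    exact (((hg' _ _).mul (hh' _ _)).add ((hg' _ _).mul (hh' _ _))).add ((hg' _ _).mul (hh' _ _))

lemma GammaR.adjugate_mem {g : Matrix (Fin 2) (Fin 2) ℂ} (hg : g ∈ GammaR) :
    g.adjugate ∈ GammaR := by
  refine ⟨by simp [Matrix.det_adjugate, hg.1], fun i j ↦ ?_, fun i j ↦ ?_⟩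
  · rw [Matrix.adjugate_fin_two]
    fin_cases i <;> fin_cases j <;> simp [hg.2.1]
  · rw [← isGauss_adjointMat_iff, adjointMat_adjugate, Matrix.transpose_apply,
      isGauss_adjointMat_iff]
    exact hg.2.2 j i

lemma GammaR.adjugate_mul {g : Matrix (Fin 2) (Fin 2) ℂ} (hg : g ∈ GammaR) :
    g.adjugate * g = 1 := by
  rw [Matrix.adjugate_mul, hg.1, one_smul]

lemma GammaR.mul_adjugate {g : Matrix (Fin 2) (Fin 2) ℂ} (hg : g ∈ GammaR) :
    g * g.adjugate = 1 := by
  rw [Matrix.mul_adjugate, hg.1, one_smul]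

/-- The integrality conditions on the entries of a real matrix `g` with `CMat g` Gaussian. -/
lemma GammaR.exists_real {g : Matrix (Fin 2) (Fin 2) ℂ} (hg : g ∈ GammaR) :
    ∃ a b c d : ℝ, g = !![(a : ℂ), b; c, d] ∧ a * d - b * c = 1 ∧
      (∃ n : ℤ, 2 * c ^ 2 = n) ∧ (∃ n : ℤ, 2 * (c * d) = n) ∧ (∃ n : ℤ, 2 * d ^ 2 = n) ∧
      (∃ n : ℤ, c ^ 2 + d ^ 2 = n) ∧ (∃ n : ℤ, a ^ 2 + c ^ 2 = n) ∧
      (∃ n : ℤ, -(a * c) + b * d = n) ∧ ∃ n : ℤ, (a ^ 2 + c ^ 2 + b ^ 2 + d ^ 2) / 2 = n := by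
  obtain ⟨hdet, him, hC⟩ := hg
  have hre : ∀ i j, ∃ r : ℝ, g i j = r := fun i j ↦
    ⟨(g i j).re, Complex.ext (by simp) (by simp [him])⟩
  obtain ⟨a, ha⟩ := hre 0 0
  obtain ⟨b, hb⟩ := hre 0 1
  obtain ⟨c, hc⟩ := hre 1 0
  obtain ⟨d, hd⟩ := hre 1 1
  have h00 := hC 0 0
  have h01 := hC 0 1
  have h02 := hC 0 2
  have h10 := hC 1 0
  have h11 := hC 1 1
  have h12 := hC 1 2
  have h20 := hC 2 0
  simp only [CMat, ha, hb, hc, hd, Matrix.of_apply, Matrix.cons_val', Matrix.cons_val_zero,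
    Matrix.cons_val_one, Matrix.cons_val, mul_div_assoc] at h00 h01 h02 h10 h11 h12 h20
  obtain ⟨n00, h00⟩ := IsGauss.exists_int_of_real
    (r := (a ^ 2 - c ^ 2 + d ^ 2 - b ^ 2) / 2) (by push_cast; exact h00)
  obtain ⟨n01, h01⟩ := IsGauss.exists_int_of_I_mul_real
    (r := (a ^ 2 - c ^ 2 + b ^ 2 - d ^ 2) / 2) (by push_cast; exact h01)
  obtain ⟨n02, h02⟩ := IsGauss.exists_int_of_real (r := c * d - a * b) (by push_cast; exact h02)
  obtain ⟨n10, h10⟩ := IsGauss.exists_int_of_I_mul_real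
    (r := (b ^ 2 + d ^ 2 - a ^ 2 - c ^ 2) / 2) (by push_cast; exact h10)
  obtain ⟨n11, h11⟩ := IsGauss.exists_int_of_real
    (r := (a ^ 2 + c ^ 2 + b ^ 2 + d ^ 2) / 2) (by push_cast; exact h11)
  obtain ⟨n12, h12⟩ := IsGauss.exists_int_of_I_mul_real
    (r := a * b + c * d) (by push_cast; exact h12)
  obtain ⟨n20, h20⟩ := IsGauss.exists_int_of_real
    (r := -(a * c) + b * d) (by push_cast; exact h20)
  refine ⟨a, b, c, d, ?_, ?_, ⟨n11 - n10 - n00 - n01, ?_⟩, ⟨n02 + n12, ?_⟩,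
    ⟨n11 + n10 + n00 - n01, ?_⟩, ⟨n11 - n01, ?_⟩, ⟨n11 - n10, ?_⟩, ⟨n20, h20⟩, ⟨n11, h11⟩⟩
  · ext i j
    fin_cases i <;> fin_cases j <;> simp [ha, hb, hc, hd]
  · rw [Matrix.det_fin_two, ha, hb, hc, hd] at hdet
    exact_mod_cast hdet
  all_goals push_cast; linarith

lemma denom_ne_zero {a b c d : ℝ} (h : a * d - b * c = 1) {z : ℂ} (hz : 0 < z.im) :
    (c : ℂ) * z + d ≠ 0 := by
  intro h0
  have him : c * z.im = 0 := by simpa using congrArg Complex.im h0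
  have hc : c = 0 := by simpa [hz.ne'] using him
  have hd : d = 0 := by simpa [hc] using h0
  simp [hc, hd] at h

lemma denom_normSq (c d : ℝ) (z : ℂ) :
    (c * z.re + d) ^ 2 + (c * z.im) ^ 2 = normSq ((c : ℂ) * z + d) := by
  simp [normSq_apply]; ring

lemma denom_normSq_pos {a b c d : ℝ} (h : a * d - b * c = 1) {z : ℂ} (hz : 0 < z.im) :
    0 < (c * z.re + d) ^ 2 + (c * z.im) ^ 2 := by
  rw [denom_normSq, normSq_pos]
  exact denom_ne_zero h hz

lemma moeb_im {a b c d : ℝ} (h : a * d - b * c = 1) (z : ℂ) :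
    (moeb !![(a : ℂ), b; c, d] z).im = z.im / ((c * z.re + d) ^ 2 + (c * z.im) ^ 2) := by
  rw [denom_normSq]
  simp only [moeb, Matrix.of_apply, Matrix.cons_val', Matrix.cons_val_zero, Matrix.cons_val_one,
    Matrix.cons_val_fin_one, Complex.div_im]
  rw [← sub_div]
  congr 1
  simp
  linear_combination z.im * h

lemma moeb_mul {g h : Matrix (Fin 2) (Fin 2) ℂ} (hg : g ∈ GammaR) (hh : h ∈ GammaR) {z : ℂ}
    (hz : 0 < z.im) : moeb (g * h) z = moeb g (moeb h z) := by
  obtain ⟨a', b', c', d', hgh, hdet', -⟩ := GammaR.exists_real (GammaR.mul_mem hg hh)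
  obtain ⟨a, b, c, d, rfl, hdet, -⟩ := GammaR.exists_real hh
  have h1 := denom_ne_zero hdet hz
  have h2 := denom_ne_zero hdet' hz
  have hc : (c' : ℂ) = g 1 0 * a + g 1 1 * c := by
    simpa [Matrix.mul_apply, Fin.sum_univ_two] using (congrFun (congrFun hgh 1) 0).symm
  have hd : (d' : ℂ) = g 1 0 * b + g 1 1 * d := by
    simpa [Matrix.mul_apply, Fin.sum_univ_two] using (congrFun (congrFun hgh 1) 1).symm
  rw [hc, hd] at h2
  have h3 : g 1 0 * (((a : ℂ) * z + b) / (c * z + d)) + g 1 1 ≠ 0 := by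
    intro h0
    apply h2
    linear_combination (c * z + d) * h0 - g 1 0 * div_mul_cancel₀ ((a : ℂ) * z + b) h1
  simp only [moeb, Matrix.mul_apply, Fin.sum_univ_two, Matrix.of_apply, Matrix.cons_val',
    Matrix.cons_val_zero, Matrix.cons_val_one, Matrix.cons_val_fin_one]
  rw [div_eq_div_iff h2 h3]
  field_simp
  ring

lemma moeb_one (z : ℂ) : moeb 1 z = z := by simp [moeb]

lemma moeb_im_pos {g : Matrix (Fin 2) (Fin 2) ℂ} (hg : g ∈ GammaR) {z : ℂ} (hz : 0 < z.im) :
    0 < (moeb g z).im := by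
  obtain ⟨a, b, c, d, rfl, hdet, -⟩ := GammaR.exists_real hg
  rw [moeb_im hdet]
  exact div_pos hz (denom_normSq_pos hdet hz)

lemma moeb_adjugate_moeb {g : Matrix (Fin 2) (Fin 2) ℂ} (hg : g ∈ GammaR) {z : ℂ}
    (hz : 0 < z.im) : moeb g.adjugate (moeb g z) = z := by
  rw [← moeb_mul (GammaR.adjugate_mem hg) hg hz, GammaR.adjugate_mul hg, moeb_one]

/-- On `F_ℝ`, the automorphy factor of an element not fixing `∞` is at least one. -/
lemma one_add_mul_le_denom_normSq {c d x y : ℝ} (hc0 : c ≠ 0) (hc : ∃ n : ℤ, 2 * c ^ 2 = n)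
    (hcd : ∃ n : ℤ, 2 * (c * d) = n) (hsum : ∃ n : ℤ, c ^ 2 + d ^ 2 = n) (hx0 : 0 ≤ x)
    (hx2 : x ≤ 2) :
    1 + c ^ 2 * ((x - 1) ^ 2 + y ^ 2 - 2) ≤ (c * x + d) ^ 2 + (c * y) ^ 2 := by
  obtain ⟨k, hk⟩ := hc
  obtain ⟨l, hl⟩ := hcd
  obtain ⟨p, hp⟩ := hsum
  have hcpos : 0 < c ^ 2 := by positivity
  have hkpos : 0 < k := by
    have : (0 : ℝ) < k := by linarith
    exact_mod_cast this
  have ht : (x - 1) ^ 2 ≤ 1 := by nlinarith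
  obtain hk1 | hk2 : k = 1 ∨ 2 ≤ k := by omega
  · subst hk1
    have hc2 : c ^ 2 = 1 / 2 := by push_cast at hk; linarith
    have hd2 : 2 * d ^ 2 = (l : ℝ) ^ 2 := by
      rw [← hl]; linear_combination (-4 * d ^ 2) * hc2
    have hlp : l ^ 2 = 2 * p - 1 := by
      have : (l : ℝ) ^ 2 = 2 * p - 1 := by linarith
      exact_mod_cast this
    have hodd : Odd l := by
      have : Odd (l ^ 2) := ⟨p - 1, by omega⟩
      exact Int.odd_pow' two_ne_zero |>.mp this
    obtain ⟨m, rfl⟩ := hodd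
    have hm : 0 ≤ m * (m + 1) := by
      rcases le_or_gt 0 m with h | h
      · exact mul_nonneg h (by omega)
      · exact mul_nonneg_of_nonpos_of_nonpos h.le (by omega)
    have hm' : 0 ≤ (m + 1) * (m + 2) := by
      rcases le_or_gt 0 (m + 1) with h | h
      · exact mul_nonneg h (by omega)
      · exact mul_nonneg_of_nonpos_of_nonpos h.le (by omega)
    have hmR : (0 : ℝ) ≤ m * (m + 1) := by exact_mod_cast hm
    have hmR' : (0 : ℝ) ≤ (m + 1) * (m + 2) := by exact_mod_cast hm'
    push_cast at hl hd2
    have hexp : (c * x + d) ^ 2 + (c * y) ^ 2 =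
        1 / 2 * (x ^ 2 + y ^ 2) + (2 * m + 1) * x + (2 * m + 1) ^ 2 / 2 := by
      linear_combination (x ^ 2 + y ^ 2) * hc2 + x * hl + hd2 / 2
    rw [hexp, hc2]
    nlinarith [mul_nonneg hx0 hmR', mul_nonneg (sub_nonneg.2 hx2) hmR]
  · have hc1 : 1 ≤ c ^ 2 := by
      have : (2 : ℝ) ≤ k := by exact_mod_cast hk2
      linarith
    nlinarith [sq_nonneg (c * (x - 1) + (c + d)), sq_nonneg (c * (x - 1) + (c + d) + c * (x - 1)),
      mul_nonneg hcpos.le (sub_nonneg.2 ht)]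

lemma strict_of_mem_interior_FR {w : ℂ} (hw : w ∈ interior FR) :
    0 < w.im ∧ 0 < w.re ∧ w.re < 2 ∧ 2 < (w.re - 1) ^ 2 + w.im ^ 2 := by
  obtain ⟨ε, hε, hball⟩ := Metric.isOpen_iff.1 isOpen_interior w hw
  have key : ∀ s : ℝ, ∀ u : ℂ, ‖u‖ = 1 → |s| < ε → w + s * u ∈ FR := fun s u hu hs ↦
    interior_subset (hball (by simpa [hu] using hs))
  have hw' := interior_subset hw
  obtain ⟨him, h0, h2, hc⟩ := hw'
  set δ := min (ε / 2) (w.im / 2) with hδ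
  have hδ0 : 0 < δ := lt_min (by linarith) (by linarith)
  have hδε : δ < ε := (min_le_left _ _).trans_lt (by linarith)
  have hδw : δ ≤ w.im / 2 := min_le_right _ _
  have hp : |δ| < ε := by rwa [abs_of_pos hδ0]
  have hn : |-δ| < ε := by rwa [abs_neg]
  have e1 := (key (-δ) 1 (by simp) hn).2.1
  have e2 := (key δ 1 (by simp) hp).2.2.1
  have e3 := (key (-δ) I (by simp) hn).2.2.2
  simp at e1 e2 e3
  exact ⟨him, by linarith, by linarith, by nlinarith⟩

lemma eq_one_or_neg_one_of_mem_FR {g : Matrix (Fin 2) (Fin 2) ℂ} (hg : g ∈ GammaR) {w : ℂ}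
    (hw : w ∈ interior FR) (hgw : moeb g w ∈ FR) : g = 1 ∨ g = -1 := by
  obtain ⟨him, h0, h2, hcirc⟩ := strict_of_mem_interior_FR hw
  have hinv := moeb_adjugate_moeb hg him
  obtain ⟨a, b, c, d, rfl, hdet, hc, hcd, -, hsum, ⟨p, hac⟩, ⟨q, hbd⟩, ⟨s, hall⟩⟩ :=
    GammaR.exists_real hg
  obtain ⟨p', hsum'⟩ := id hsum
  have hy := moeb_im hdet w
  by_cases hc0 : c = 0
  · subst hc0
    have had : a * d = 1 := by linarith
    have hpp : p * p' = 1 := by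
      have : (p : ℝ) * p' = 1 := by
        rw [← hac, ← hsum']; linear_combination (a * d + 1) * had
      exact_mod_cast this
    have hp'1 : p' = 1 := by
      have h0 : (0 : ℝ) ≤ p' := by rw [← hsum']; positivity
      have h0' : 0 ≤ p' := by exact_mod_cast h0
      rcases Int.eq_one_or_neg_one_of_mul_eq_one' hpp with h | h <;> omega
    have hd2 : d ^ 2 = 1 := by rw [hp'1] at hsum'; push_cast at hsum'; linarith
    have had' : a = d := by linear_combination d * had - a * hd2
    subst had'
    have hqb : (q : ℝ) ^ 2 = b ^ 2 := by rw [← hbd]; linear_combination b ^ 2 * hd2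
    have hq : Even q := by
      have h1 : q ^ 2 = 2 * (s - 1) := by
        have : (q : ℝ) ^ 2 = 2 * (s - 1) := by rw [hqb, ← hall]; linarith
        exact_mod_cast this
      have : Even (q ^ 2) := ⟨s - 1, by omega⟩
      exact (Int.even_pow' two_ne_zero).1 this
    have hne : (a : ℂ) ≠ 0 := by
      rintro h
      have : a = 0 := by exact_mod_cast h
      simp [this] at hd2
    have hmz : moeb !![(a : ℂ), b; (0 : ℝ), a] w = w + ((q : ℝ) : ℂ) := by
      rw [← hbd]
      have h2 : (a : ℂ) ^ 2 = 1 := by exact_mod_cast hd2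
      simp [moeb]
      field_simp
      linear_combination (-(b : ℂ)) * h2
    rw [hmz] at hgw
    obtain ⟨-, h0', h2', -⟩ := hgw
    simp only [add_re, ofReal_re] at h0' h2'
    have hql : -2 < q := by
      have : (-2 : ℝ) < q := by linarith
      exact_mod_cast this
    have hqr : q < 2 := by
      have : (q : ℝ) < 2 := by linarith
      exact_mod_cast this
    obtain rfl : q = 0 := by
      obtain ⟨r, rfl⟩ := hq
      omega
    have hb : b = 0 := by simpa using hqb.symm
    subst hb
    rcases eq_or_eq_neg_of_sq_eq_sq a 1 (by rw [hd2, one_pow]) with rfl | rfl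
    · left
      ext i j
      fin_cases i <;> fin_cases j <;> simp
    · right
      ext i j
      fin_cases i <;> fin_cases j <;> simp
  · exfalso
    have hlt : (moeb !![(a : ℂ), b; c, d] w).im < w.im := by
      rw [hy]
      apply div_lt_self him
      have := one_add_mul_le_denom_normSq (y := w.im) hc0 hc hcd hsum h0.le h2.le
      have := mul_pos (by positivity : 0 < c ^ 2) (sub_pos.2 hcirc)
      linarith
    set v := moeb !![(a : ℂ), b; c, d] w with hv
    obtain ⟨hvim, hv0, hv2, hvc⟩ := hgw
    obtain ⟨a', b', c', d', hadj, hdet', hc', hcd', -, hsum', -⟩ :=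
      GammaR.exists_real (GammaR.adjugate_mem hg)
    have hcc : c' = -c := by
      have := congrFun (congrFun hadj 1) 0
      simp [Matrix.adjugate_fin_two] at this
      exact_mod_cast this.symm
    have hc0' : c' ≠ 0 := by simpa [hcc] using hc0
    have hge := one_add_mul_le_denom_normSq (y := v.im) hc0' hc' hcd' hsum' hv0 hv2
    have hnn := mul_nonneg (sq_nonneg c') (sub_nonneg.2 hvc)
    have hy' := moeb_im hdet' v
    rw [← hadj, hinv] at hy'
    have : w.im ≤ v.im := by
      rw [hy']
      exact div_le_self hvim.le (by linarith)
    linarith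

lemma mem_GammaR_of_real {a b c d : ℝ} (hdet : a * d - b * c = 1)
    (h00 : ∃ n : ℤ, (a ^ 2 - c ^ 2 + d ^ 2 - b ^ 2) / 2 = n)
    (h01 : ∃ n : ℤ, (a ^ 2 - c ^ 2 + b ^ 2 - d ^ 2) / 2 = n)
    (h02 : ∃ n : ℤ, c * d - a * b = n)
    (h10 : ∃ n : ℤ, (b ^ 2 + d ^ 2 - a ^ 2 - c ^ 2) / 2 = n)
    (h11 : ∃ n : ℤ, (a ^ 2 + c ^ 2 + b ^ 2 + d ^ 2) / 2 = n)
    (h12 : ∃ n : ℤ, a * b + c * d = n)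
    (h20 : ∃ n : ℤ, -(a * c) + b * d = n)
    (h21 : ∃ n : ℤ, a * c + b * d = n)
    (h22 : ∃ n : ℤ, a * d + b * c = n) :
    !![(a : ℂ), b; c, d] ∈ GammaR := by
  have real : ∀ r : ℝ, (∃ n : ℤ, r = n) → IsGauss r := by
    rintro r ⟨n, rfl⟩
    simpa using isGauss_intCast n
  have imag : ∀ r : ℝ, (∃ n : ℤ, r = n) → IsGauss (I * r) := by
    rintro r ⟨n, rfl⟩
    simpa using isGauss_I_mul_intCast n
  refine ⟨?_, fun i j ↦ ?_, fun i j ↦ ?_⟩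
  · rw [Matrix.det_fin_two]
    simp only [Matrix.of_apply, Matrix.cons_val', Matrix.cons_val_zero, Matrix.cons_val_one,
      Matrix.cons_val_fin_one]
    exact_mod_cast hdet
  · fin_cases i <;> fin_cases j <;> simp
  · fin_cases i <;> fin_cases j
    · simpa [CMat] using real _ h00
    · simpa [CMat, mul_div_assoc] using imag _ h01
    · simpa [CMat] using real _ h02
    · simpa [CMat, mul_div_assoc] using imag _ h10
    · simpa [CMat] using real _ h11
    · simpa [CMat] using imag _ h12
    · simpa [CMat] using real _ h20
    · simpa [CMat] using imag _ h21
    · simpa [CMat] using real _ h22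

lemma one_mem_GammaR : (1 : Matrix (Fin 2) (Fin 2) ℂ) ∈ GammaR := by
  have h := mem_GammaR_of_real (a := 1) (b := 0) (c := 0) (d := 1) (by norm_num)
    ⟨1, by norm_num⟩ ⟨0, by norm_num⟩ ⟨0, by norm_num⟩ ⟨0, by norm_num⟩ ⟨1, by norm_num⟩
    ⟨0, by norm_num⟩ ⟨0, by norm_num⟩ ⟨0, by norm_num⟩ ⟨1, by norm_num⟩
  rw [Matrix.one_fin_two]
  simpa using h

lemma translation_mem_GammaR (n : ℤ) :
    !![((1 : ℝ) : ℂ), (2 * n : ℝ); (0 : ℝ), (1 : ℝ)] ∈ GammaR :=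
  mem_GammaR_of_real (by norm_num)
    ⟨1 - 2 * n ^ 2, by push_cast; ring⟩ ⟨2 * n ^ 2, by push_cast; ring⟩
    ⟨-2 * n, by push_cast; ring⟩ ⟨2 * n ^ 2, by push_cast; ring⟩
    ⟨1 + 2 * n ^ 2, by push_cast; ring⟩ ⟨2 * n, by push_cast; ring⟩
    ⟨2 * n, by push_cast; ring⟩ ⟨2 * n, by push_cast; ring⟩ ⟨1, by norm_num⟩

/-- The elliptic element of order two fixing `1 + √2 i`. -/
lemma elliptic_mem_GammaR :
    !![((√2 / 2 : ℝ) : ℂ), (-3 * (√2 / 2) : ℝ); (√2 / 2 : ℝ), (-(√2 / 2) : ℝ)] ∈ GammaR := by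
  have h : (√2 / 2) ^ 2 = 1 / 2 := by
    rw [div_pow, Real.sq_sqrt (by norm_num)]; norm_num
  refine mem_GammaR_of_real ?_ ⟨-2, ?_⟩ ⟨2, ?_⟩ ⟨1, ?_⟩ ⟨2, ?_⟩ ⟨3, ?_⟩ ⟨-2, ?_⟩ ⟨1, ?_⟩ ⟨2, ?_⟩
    ⟨-2, ?_⟩ <;> push_cast <;> nlinarith [h]

/-- Among the `Γ'_ℝ`-translates of a point there is one of maximal height. -/
lemma exists_max_im {z : ℂ} (hz : 0 < z.im) :
    ∃ g ∈ GammaR, ∀ h ∈ GammaR, (moeb h z).im ≤ (moeb g z).im := by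
  set x := z.re with hx
  set y := z.im with hy
  set S : Set ℝ := {t | ∃ g ∈ GammaR, (moeb g z).im = t ∧ y ≤ t} with hS
  have hfin : S.Finite := by
    set K : ℤ := ⌈2 / y ^ 2⌉ with hK
    set M : ℤ := ⌈4 + 2 * (2 / y ^ 2) * x ^ 2⌉ with hM
    refine (((Set.finite_Icc (0 : ℤ) K).prod ((Set.finite_Icc (-(K + M)) (K + M)).prod
      (Set.finite_Icc (0 : ℤ) M))).image fun p : ℤ × ℤ × ℤ ↦
        y / ((p.1 * (x ^ 2 + y ^ 2) + 2 * p.2.1 * x + p.2.2) / 2)).subset ?_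
    rintro t ⟨g, hg, rfl, ht⟩
    obtain ⟨a, b, c, d, rfl, hdet, ⟨k, hk⟩, ⟨l, hl⟩, ⟨m, hm⟩, -⟩ := GammaR.exists_real hg
    rw [moeb_im hdet] at ht ⊢
    have hpos := denom_normSq_pos hdet hz
    rw [← hx, ← hy] at *
    have hN : (c * x + d) ^ 2 + (c * y) ^ 2 ≤ 1 := by
      rw [le_div_iff₀ hpos] at ht
      by_contra! hcon
      nlinarith
    have hk' : (k : ℝ) ≤ 2 / y ^ 2 := by
      rw [le_div_iff₀ (by positivity), ← hk]
      nlinarith [sq_nonneg (c * x + d)]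
    have hm' : (m : ℝ) ≤ 4 + 2 * (2 / y ^ 2) * x ^ 2 := by
      have h1 : (m : ℝ) ≤ 4 + 2 * k * x ^ 2 := by
        rw [← hm, ← hk]
        nlinarith [sq_nonneg (c * y), sq_nonneg (2 * c * x + d)]
      nlinarith [mul_le_mul_of_nonneg_right hk' (sq_nonneg x)]
    have hkK : k ≤ K := by exact_mod_cast hk'.trans (Int.le_ceil _)
    have hmM : m ≤ M := by exact_mod_cast hm'.trans (Int.le_ceil _)
    have hk0 : 0 ≤ k := by
      have : (0 : ℝ) ≤ k := by rw [← hk]; positivity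
      exact_mod_cast this
    have hm0 : 0 ≤ m := by
      have : (0 : ℝ) ≤ m := by rw [← hm]; positivity
      exact_mod_cast this
    have hl1 : l ≤ k + m := by
      have : (l : ℝ) ≤ k + m := by
        rw [← hk, ← hm, ← hl]; nlinarith [sq_nonneg (c - d), sq_nonneg c, sq_nonneg d]
      exact_mod_cast this
    have hl2 : -(k + m) ≤ l := by
      have : -((k : ℝ) + m) ≤ l := by
        rw [← hk, ← hm, ← hl]; nlinarith [sq_nonneg (c + d), sq_nonneg c, sq_nonneg d]
      exact_mod_cast this
    refine ⟨(k, l, m), ⟨⟨hk0, hkK⟩, ⟨by simp; omega, by simp; omega⟩, ⟨hm0, hmM⟩⟩, ?_⟩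
    simp only
    congr 1
    rw [← hk, ← hl, ← hm]
    ring
  obtain ⟨t, ⟨g, hg, rfl, hge⟩, hmax⟩ := Set.exists_max_image S id hfin
    ⟨y, 1, one_mem_GammaR, by rw [moeb_one], le_rfl⟩
  refine ⟨g, hg, fun h hh ↦ ?_⟩
  rcases le_total y (moeb h z).im with h1 | h1
  · exact hmax _ ⟨h, hh, rfl, h1⟩
  · exact h1.trans hge

lemma exists_moeb_mem_FR {z : ℂ} (hz : 0 < z.im) : ∃ g ∈ GammaR, moeb g z ∈ FR := by
  obtain ⟨g, hg, hmax⟩ := exists_max_im hz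
  set n : ℤ := -⌊(moeb g z).re / 2⌋ with hn
  have hT := translation_mem_GammaR n
  set T : Matrix (Fin 2) (Fin 2) ℂ := !![((1 : ℝ) : ℂ), (2 * n : ℝ); (0 : ℝ), (1 : ℝ)] with hTdef
  have hTg := GammaR.mul_mem hT hg
  have hw : moeb (T * g) z = moeb g z + ((2 * n : ℝ) : ℂ) := by
    rw [moeb_mul hT hg hz]
    simp [moeb, hTdef]
  set w := moeb (T * g) z with hwdef
  have hwim : w.im = (moeb g z).im := by rw [hw]; simp
  have hwre : w.re = (moeb g z).re + 2 * n := by rw [hw, add_re, ofReal_re]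
  have hwpos : 0 < w.im := moeb_im_pos hTg hz
  have h1 := Int.floor_le ((moeb g z).re / 2)
  have h2 := Int.lt_floor_add_one ((moeb g z).re / 2)
  refine ⟨T * g, hTg, hwpos, ?_, ?_, ?_⟩
  · rw [← hwdef, hwre, hn]; push_cast; linarith
  · rw [← hwdef, hwre, hn]; push_cast; linarith
  · rw [← hwdef]
    by_contra! hlt
    have hE := elliptic_mem_GammaR
    have h := hmax _ (GammaR.mul_mem hE hTg)
    rw [moeb_mul hE hTg hz, ← hwdef, ← hwim] at h
    have hs : (√2 / 2) ^ 2 = 1 / 2 := by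
      rw [div_pow, Real.sq_sqrt (by norm_num)]; norm_num
    have hdet' : √2 / 2 * (-(√2 / 2)) - (-3 * (√2 / 2)) * (√2 / 2) = 1 := by nlinarith
    rw [moeb_im hdet'] at h
    have hpos := denom_normSq_pos hdet' hwpos
    rw [div_le_iff₀ hpos] at h
    have hden : (√2 / 2 * w.re + -(√2 / 2)) ^ 2 + (√2 / 2 * w.im) ^ 2 =
        ((w.re - 1) ^ 2 + w.im ^ 2) / 2 := by
      linear_combination ((w.re - 1) ^ 2 + w.im ^ 2) * hs
    rw [hden] at h
    nlinarith

/-- If `γ₁ w₁ = γ₂ w₂` with `γ₁ ≠ ±γ₂` and `w₁, w₂ ∈ F_ℝ`, then `w₁` is a frontier point. -/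
lemma mem_frontier_FR {g₁ g₂ : Matrix (Fin 2) (Fin 2) ℂ} (h₁ : g₁ ∈ GammaR) (h₂ : g₂ ∈ GammaR)
    (hne : g₁ ≠ g₂) (hne' : g₁ ≠ -g₂) {w₁ w₂ : ℂ} (hw₁ : w₁ ∈ FR) (hw₂ : w₂ ∈ FR)
    (h : moeb g₁ w₁ = moeb g₂ w₂) : w₁ ∈ frontier FR := by
  refine ⟨subset_closure hw₁, fun hint ↦ ?_⟩
  have hmem := GammaR.mul_mem (GammaR.adjugate_mem h₂) h₁
  have hFR : moeb (g₂.adjugate * g₁) w₁ ∈ FR := by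
    rwa [moeb_mul (GammaR.adjugate_mem h₂) h₁ hw₁.1, h, moeb_adjugate_moeb h₂ hw₂.1]
  have hg : g₂ * (g₂.adjugate * g₁) = g₁ := by
    rw [← mul_assoc, GammaR.mul_adjugate h₂, one_mul]
  rcases eq_one_or_neg_one_of_mem_FR hmem hint hFR with h1 | h1
  · rw [h1, mul_one] at hg
    exact hne hg.symm
  · rw [h1, mul_neg, mul_one] at hg
    exact hne' hg.symm

/-- `F_ℝ` is an exact fundamental domain for the Möbius action of `Γ'_ℝ` on `ℍ`: its
`Γ'_ℝ`-translates cover `ℍ`, and translates by `γ₁ ≠ ±γ₂` meet only along images of the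
frontier `∂F_ℝ`. -/
theorem stmt17 :
    (∀ z : ℂ, 0 < z.im → ∃ γ ∈ GammaR, ∃ w ∈ FR, moeb γ w = z) ∧
    (∀ γ₁ ∈ GammaR, ∀ γ₂ ∈ GammaR, γ₁ ≠ γ₂ → γ₁ ≠ -γ₂ →
      (moeb γ₁ '' FR) ∩ (moeb γ₂ '' FR) ⊆
        (moeb γ₁ '' frontier FR) ∩ (moeb γ₂ '' frontier FR)) := by
  refine ⟨fun z hz ↦ ?_, ?_⟩
  · obtain ⟨g, hg, hgz⟩ := exists_moeb_mem_FR hz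
    exact ⟨g.adjugate, GammaR.adjugate_mem hg, moeb g z, hgz, moeb_adjugate_moeb hg hz⟩
  · rintro g₁ h₁ g₂ h₂ hne hne' x ⟨⟨w₁, hw₁, rfl⟩, ⟨w₂, hw₂, h⟩⟩
    exact ⟨⟨w₁, mem_frontier_FR h₁ h₂ hne hne' hw₁ hw₂ h.symm, rfl⟩,
      ⟨w₂, mem_frontier_FR h₂ h₁ hne.symm (fun e ↦ hne' (by rw [e, neg_neg])) hw₂ hw₁ h, h⟩⟩
end
end

section
/- Let μ be a left-invariant Haar measure on SL(2,ℂ) and ν a left-invariant Haar measure on SL(2,ℝ). If S ⊆ SL(2,ℂ) is a measurable fundamental domain for the action of the subgroup Γ' on SL(2,ℂ) by left multiplication and S₀ is a measurable fundamental domain for the subgroup SL(2,ℤ[i]), then μ(S) = (1/2)·μ(S₀). If S' ⊆ SL(2,ℝ) is a measurable fundamental domain for the action of Γ'_ℝ = Γ' ∩ SL(2,ℝ) by left multiplication and S₀' is a measurable fundamental domain for SL(2,ℤ), then ν(S') = (3/2)·ν(S₀'). -/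
open Complex Matrix MeasureTheory

noncomputable section

abbrev SL2C := Matrix.SpecialLinearGroup (Fin 2) ℂ
abbrev SL2R := Matrix.SpecialLinearGroup (Fin 2) ℝ

instance : TopologicalSpace SL2C :=
  TopologicalSpace.induced (fun g => (g : Matrix (Fin 2) (Fin 2) ℂ)) inferInstance

instance : TopologicalSpace SL2R :=
  TopologicalSpace.induced (fun g => (g : Matrix (Fin 2) (Fin 2) ℝ)) inferInstance

instance : MeasurableSpace SL2C := borel _
instance : MeasurableSpace SL2R := borel _

/-- `Γ'` as a subset of `SL(2,ℂ)`. -/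
def GammaSL : Set SL2C :=
  {g | ∀ i j, IsGauss (CMat (g : Matrix (Fin 2) (Fin 2) ℂ) i j)}

/-- `SL(2,ℤ[i])` as a subset of `SL(2,ℂ)`. -/
def SL2ZiSL : Set SL2C :=
  {g | ∀ i j, IsGauss ((g : Matrix (Fin 2) (Fin 2) ℂ) i j)}

/-- `Γ'_ℝ = Γ' ∩ SL(2,ℝ)` as a subset of `SL(2,ℝ)`. -/
def GammaRSL : Set SL2R :=
  {g | ∀ i j, IsGauss (CMat ((g : Matrix (Fin 2) (Fin 2) ℝ).map (fun t : ℝ => (t : ℂ))) i j)}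

/-- `SL(2,ℤ)` as a subset of `SL(2,ℝ)`. -/
def SL2ZSL : Set SL2R :=
  {g | ∀ i j, ∃ n : ℤ, (g : Matrix (Fin 2) (Fin 2) ℝ) i j = (n : ℝ)}

section CovolumeTransfer

open scoped Pointwise

variable {G : Type*} [Group G] [MeasurableSpace G] [MeasurableConstSMul G G] {μ : Measure G}
  [SMulInvariantMeasure G G μ]

/-- If `S` is a fundamental domain for `H`, then `c • S` is one for `c H c⁻¹`. -/
theorem isFundamentalDomain_smul_conj {H : Subgroup G} {S : Set G}
    (hS : IsFundamentalDomain H S μ) (c : G) :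
    IsFundamentalDomain (H.map (MulAut.conj c).toMonoidHom) (c • S) μ := by
  refine hS.image_of_equiv (MulAction.toPerm c)
    (measurePreserving_smul c⁻¹ μ).quasiMeasurePreserving
    ((MulAut.conj c).subgroupMap H).symm.toEquiv fun g x => ?_
  obtain ⟨g, rfl⟩ := ((MulAut.conj c).subgroupMap H).surjective g
  change c * ((((MulAut.conj c).subgroupMap H).symm (((MulAut.conj c).subgroupMap H) g) : G) * x) =
    c * g * c⁻¹ * (c * x)
  simp [mul_assoc]

/-- If `r` is a system of representatives for the right cosets of `K` in `H` and `S` is a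
fundamental domain for `H`, then the union of the translates `r i • S` is one for `K`. -/
theorem isFundamentalDomain_iUnion_smul {H K : Subgroup G} {S : Set G}
    (hS : IsFundamentalDomain H S μ) (hKH : K ≤ H) {ι : Type*} [Countable ι] (r : ι → G)
    (hr : ∀ i, r i ∈ H) (hu : ∀ h ∈ H, ∃! i, h * (r i)⁻¹ ∈ K) :
    IsFundamentalDomain K (⋃ i, r i • S) μ where
  nullMeasurableSet := .iUnion fun i => hS.nullMeasurableSet.smul (r i)
  ae_covers := by
    filter_upwards [hS.ae_covers] with x ⟨h, hx⟩
    obtain ⟨i, hi, -⟩ := hu _ (inv_mem h.2)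
    refine ⟨⟨r i * h, by simpa using inv_mem hi⟩, Set.mem_iUnion.2 ⟨i, ?_⟩⟩
    simpa [Set.mem_smul_set_iff_inv_smul_mem, Subgroup.smul_def, mul_assoc] using hx
  aedisjoint := by
    intro k k' hkk
    simp only [Function.onFun, Set.smul_set_iUnion, AEDisjoint.iUnion_left_iff,
      AEDisjoint.iUnion_right_iff]
    intro j i
    have hne : (⟨k * r i, mul_mem (hKH k.2) (hr i)⟩ : H) ≠
        ⟨k' * r j, mul_mem (hKH k'.2) (hr j)⟩ := by
      intro h
      rw [Subtype.mk.injEq] at h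
      obtain ⟨l, -, hl⟩ := hu _ (mul_mem (hKH k.2) (hr i))
      have hi := hl i (by simp)
      have hj := hl j (by rw [h]; simp)
      subst hi; subst hj
      exact hkk (Subtype.ext (mul_right_cancel h))
    have := hS.aedisjoint hne
    simpa [Function.onFun, Subgroup.smul_def, mul_smul] using this

theorem measure_iUnion_smul {H K : Subgroup G} {S : Set G}
    (hS : IsFundamentalDomain H S μ) {ι : Type*} [Fintype ι] (r : ι → G)
    (hr : ∀ i, r i ∈ H) (hu : ∀ h ∈ H, ∃! i, h * (r i)⁻¹ ∈ K) :
    μ (⋃ i, r i • S) = Fintype.card ι * μ S := by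
  rw [measure_iUnion₀ _ fun i => hS.nullMeasurableSet.smul (r i)]
  · simp
  · intro i j hij
    have hne : (⟨r i, hr i⟩ : H) ≠ ⟨r j, hr j⟩ := by
      intro h
      rw [Subtype.mk.injEq] at h
      obtain ⟨l, -, hl⟩ := hu _ (hr i)
      exact hij ((hl i (by simp)).trans (hl j (by rw [h]; simp)).symm)
    exact hS.aedisjoint hne

/-- Covolumes are multiplied by the number of cosets on passing to a subgroup. -/
theorem measure_eq_card_mul_of_cosets {H K : Subgroup G} [Countable K] {S T : Set G}
    (hS : IsFundamentalDomain H S μ) (hT : IsFundamentalDomain K T μ) (hKH : K ≤ H)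
    {ι : Type*} [Fintype ι] (r : ι → G)
    (hr : ∀ i, r i ∈ H) (hu : ∀ h ∈ H, ∃! i, h * (r i)⁻¹ ∈ K) :
    μ T = Fintype.card ι * μ S :=
  (hT.measure_eq (isFundamentalDomain_iUnion_smul hS hKH r hr hu)).trans
    (measure_iUnion_smul hS r hr hu)

end CovolumeTransfer

section Topology

instance : BorelSpace SL2C := ⟨rfl⟩
instance : BorelSpace SL2R := ⟨rfl⟩

instance : ContinuousMul SL2C :=
  @IsTopologicalGroup.toContinuousMul SL2C _ _ Matrix.SpecialLinearGroup.topologicalGroup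
instance : ContinuousMul SL2R :=
  @IsTopologicalGroup.toContinuousMul SL2R _ _ Matrix.SpecialLinearGroup.topologicalGroup

end Topology

section Primitive

variable {R F : Type*} [CommRing R] [IsDomain R] [IsPrincipalIdealRing R] [Field F]

theorem exists_eq_smul_of_mul_mem_range {φ : R →+* F} {ι : Type*} [Fintype ι]
    {v : ι → F} (hv : v ≠ 0) {e : F} (he : e ≠ 0) (hev : ∀ i, e * v i ∈ φ.range) {k : F}
    (hk : ∀ i, k * v i ^ 2 ∈ φ.range) :
    ∃ (u : F) (m : ι → R), (∀ i, v i = u * φ (m i)) ∧ k * u ^ 2 ∈ φ.range := by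
  choose w hw using hev
  obtain ⟨δ, hδ⟩ : ∃ δ, Ideal.span (Set.range w) = Ideal.span {δ} :=
    (IsPrincipalIdealRing.principal (Ideal.span (Set.range w))).principal
  have hdvd : ∀ i, ∃ m, w i = δ * m := fun i =>
    Ideal.mem_span_singleton.1 (hδ ▸ Ideal.subset_span (Set.mem_range_self i))
  choose m hm using hdvd
  have hδ0 : δ ≠ 0 := by
    rintro rfl
    refine hv (funext fun i => ?_)
    have := hw i
    simpa [hm, he] using this.symm
  have htop : Ideal.span (Set.range m) = ⊤ := by
    obtain ⟨s, hs⟩ := (Ideal.mem_span_range_iff_exists_fun (v := w)).1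
      (hδ ▸ Ideal.mem_span_singleton_self δ)
    refine (Ideal.eq_top_iff_one _).2 ((Ideal.mem_span_range_iff_exists_fun).2 ⟨s, ?_⟩)
    apply mul_left_cancel₀ hδ0
    rw [Finset.mul_sum, mul_one]
    refine (Finset.sum_congr rfl fun i _ => ?_).trans hs
    rw [hm, mul_left_comm]
  have hsq := Ideal.span_pow_eq_top _ htop 2
  rw [← Set.range_comp, Ideal.eq_top_iff_one, Ideal.mem_span_range_iff_exists_fun] at hsq
  obtain ⟨t, ht⟩ := hsq
  have hvm : ∀ i, v i = φ δ / e * φ (m i) := fun i => by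
    rw [div_mul_eq_mul_div, eq_div_iff he, ← map_mul, ← hm, hw, mul_comm]
  refine ⟨φ δ / e, m, hvm, ?_⟩
  have : k * (φ δ / e) ^ 2 = ∑ i, φ (t i) * (k * v i ^ 2) := by
    have h1 := congrArg φ ht
    simp only [map_sum, map_mul, map_one, Function.comp, map_pow] at h1
    rw [← mul_one (k * _), ← h1, Finset.mul_sum]
    refine Finset.sum_congr rfl fun i _ => ?_
    rw [hvm i]; ring
  rw [this]
  exact sum_mem fun i _ => mul_mem ⟨_, rfl⟩ (hk i)

end Primitive

section Gaussian

theorem isGauss_iff_mem_range {z : ℂ} : IsGauss z ↔ z ∈ GaussianInt.toComplex.range := by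
  constructor
  · rintro ⟨a, b, rfl⟩
    exact ⟨⟨a, b⟩, by simp [GaussianInt.toComplex_def]⟩
  · rintro ⟨x, rfl⟩
    exact ⟨x.re, x.im, GaussianInt.toComplex_def x⟩

theorem I_mem_range_toComplex : Complex.I ∈ GaussianInt.toComplex.range :=
  isGauss_iff_mem_range.1 ⟨0, 1, by simp⟩

theorem I_mul_mem_range_toComplex_iff {z : ℂ} :
    Complex.I * z ∈ GaussianInt.toComplex.range ↔ z ∈ GaussianInt.toComplex.range := by
  refine ⟨fun h => ?_, mul_mem I_mem_range_toComplex⟩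
  have := neg_mem (mul_mem I_mem_range_toComplex h)
  rwa [← mul_assoc, Complex.I_mul_I, neg_one_mul, neg_neg] at this

theorem mem_range_toComplex_of_sq {z : ℂ} (hz : z ^ 2 = 1 ∨ z ^ 2 = -1) :
    z ∈ GaussianInt.toComplex.range := by
  rcases hz with hz | hz
  · rw [← one_pow 2, sq_eq_sq_iff_eq_or_eq_neg] at hz
    rcases hz with rfl | rfl
    · exact one_mem _
    · exact neg_mem (one_mem _)
  · rw [← Complex.I_sq, sq_eq_sq_iff_eq_or_eq_neg] at hz
    rcases hz with rfl | rfl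
    · exact I_mem_range_toComplex
    · exact neg_mem I_mem_range_toComplex

/-- Gaussian integrality of the adjoint matrix, read off after conjugating by
`!![1, 1 + i; 1, 0]`. -/
theorem isGauss_cMat_conj_iff (a b c d : ℂ) (hdet : a * d - b * c = 1) :
    (∀ i j, IsGauss (CMat !![(1 - I) / 2 * b + d, a + (1 + I) * c - (1 - I) / 2 * b - d;
        (1 - I) / 2 * b, a - (1 - I) / 2 * b] i j)) ↔
      ∀ z ∈ [a ^ 2, b ^ 2, c ^ 2, d ^ 2, (1 - I) * (a * b), (1 + I) * (a * c),
        (1 - I) * (b * d), (1 + I) * (c * d), a * d + b * c],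
        z ∈ GaussianInt.toComplex.range := by
  have hC : CMat !![(1 - I) / 2 * b + d, a + (1 + I) * c - (1 - I) / 2 * b - d;
        (1 - I) / 2 * b, a - (1 - I) / 2 * b] =
      !![(a * d + b * c) - I * c ^ 2 - ((1 + I) * (a * c) - (1 + I) * (c * d)),
        I * ((1 - I) * (b * d) + d ^ 2 - (a * d + b * c) + I * c ^ 2
          + ((1 + I) * (a * c) - (1 + I) * (c * d))),
        (1 - I) * (b * d) + d ^ 2 - (a * d + b * c) - (1 + I) * (c * d);
        I * (a ^ 2 - (a * d + b * c) + I * c ^ 2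
          + ((1 + I) * (a * c) - (1 + I) * (c * d)) - (1 - I) * (a * b)),
        a ^ 2 - (a * d + b * c) + I * c ^ 2 + ((1 + I) * (a * c) - (1 + I) * (c * d))
          - (1 - I) * (a * b) - I * b ^ 2 + (1 - I) * (b * d) + d ^ 2,
        I * ((1 - I) * (a * b) - (1 - I) * (b * d) + (a * d + b * c) - d ^ 2
          + (1 + I) * (c * d) + I * b ^ 2);
        a ^ 2 - (a * d + b * c) + (1 + I) * (a * c) - (1 - I) * (a * b),
        I * (a ^ 2 - (a * d + b * c) + (1 + I) * (a * c) - (1 - I) * (a * b)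
          + (1 - I) * (b * d) - I * b ^ 2),
        (1 - I) * (a * b) - (1 - I) * (b * d) + (a * d + b * c) + I * b ^ 2] := by
    have hI := Complex.I_sq
    ext i j
    fin_cases i <;> fin_cases j <;> simp [CMat] <;> grind
  simp only [hC, Fin.forall_fin_succ, isGauss_iff_mem_range]
  simp only [Matrix.of_apply, Matrix.cons_val', Matrix.cons_val_zero, Matrix.cons_val_one,
    Matrix.cons_val_succ, Matrix.cons_val_fin_one, Fin.succ_zero_eq_one, IsEmpty.forall_iff,
    and_true, Fin.isValue, I_mul_mem_range_toComplex_iff, List.forall_mem_cons, List.not_mem_nil]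
  generalize (1 - I) * (a * b) = ab
  generalize (1 + I) * (a * c) = ac
  generalize (1 - I) * (b * d) = bd
  generalize (1 + I) * (c * d) = cd
  generalize a * d + b * c = e
  generalize a ^ 2 = aa
  generalize b ^ 2 = bb
  generalize c ^ 2 = cc
  generalize d ^ 2 = dd
  constructor
  · rintro ⟨⟨h00, h01, h02⟩, ⟨h10, h11, h12⟩, h20, h21, h22⟩
    have hbd' : bd + dd ∈ GaussianInt.toComplex.range := by
      convert add_mem h00 h01 using 1; ring
    have hbb : I * bb ∈ GaussianInt.toComplex.range := by
      convert sub_mem (add_mem hbd' h10) h11 using 1; ring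
    have hbd : bd ∈ GaussianInt.toComplex.range := by
      convert add_mem (sub_mem h21 h20) hbb using 1; ring
    have hdd : dd ∈ GaussianInt.toComplex.range := by
      convert sub_mem hbd' hbd using 1; ring
    have hcd : cd ∈ GaussianInt.toComplex.range := by
      convert add_mem (sub_mem h12 h22) hdd using 1; ring
    have he : e ∈ GaussianInt.toComplex.range := by
      convert sub_mem hbd' (add_mem h02 hcd) using 1; ring
    have hab : ab ∈ GaussianInt.toComplex.range := by
      convert sub_mem (sub_mem (add_mem h22 hbd) he) hbb using 1; ring
    have hcc : I * cc ∈ GaussianInt.toComplex.range := by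
      convert add_mem (sub_mem h10 h20) hcd using 1; ring
    have hac : ac ∈ GaussianInt.toComplex.range := by
      convert sub_mem (add_mem he hcd) (add_mem h00 hcc) using 1; ring
    have haa : aa ∈ GaussianInt.toComplex.range := by
      convert sub_mem (add_mem (add_mem h20 he) hab) hac using 1; ring
    exact ⟨haa, I_mul_mem_range_toComplex_iff.1 hbb, I_mul_mem_range_toComplex_iff.1 hcc, hdd,
      hab, hac, hbd, hcd, he, fun _ => trivial⟩
  · rintro ⟨haa, hbb, hcc, hdd, hab, hac, hbd, hcd, he, -⟩
    have hbb := I_mul_mem_range_toComplex_iff.2 hbb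
    have hcc := I_mul_mem_range_toComplex_iff.2 hcc
    refine ⟨⟨?_, ?_, ?_⟩, ⟨?_, ?_, ?_⟩, ?_, ?_, ?_⟩ <;>
      repeat first | assumption | apply add_mem | apply sub_mem

theorem isUnit_gaussianInt_toComplex {n : GaussianInt} (hn : IsUnit n) :
    (n : ℂ) ^ 2 = 1 ∨ (n : ℂ) = I ∨ (n : ℂ) = -I := by
  have h := (Zsqrtd.norm_eq_one_iff' (by norm_num) n).2 hn
  rw [Zsqrtd.norm_def] at h
  have h1 : n.re ≤ 1 := by nlinarith [mul_self_nonneg n.im]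
  have h2 : -1 ≤ n.re := by nlinarith [mul_self_nonneg n.im]
  have h3 : n.im ≤ 1 := by nlinarith [mul_self_nonneg n.re]
  have h4 : -1 ≤ n.im := by nlinarith [mul_self_nonneg n.re]
  rw [GaussianInt.toComplex_def]
  generalize n.re = x at *
  generalize n.im = y at *
  interval_cases x <;> interval_cases y <;> simp_all

/-- A matrix of determinant one whose squared entries, and doubled products of entries, are
Gaussian integers is Gaussian up to a scalar whose square is a unit. -/
theorem exists_scalar_of_gaussian_products (h : SL2C)
    (hsq : ∀ i j, h i j ^ 2 ∈ GaussianInt.toComplex.range)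
    (hmul : ∀ i j k l, 2 * h i j * h k l ∈ GaussianInt.toComplex.range) :
    ∃ u : ℂ, (u ^ 4 = 1 ∨ u ^ 2 = I ∨ u ^ 2 = -I) ∧
      ∀ i j, ∃ z ∈ GaussianInt.toComplex.range, h i j = u * z := by
  have hdet : h 0 0 * h 1 1 - h 0 1 * h 1 0 = 1 := by
    rw [← Matrix.det_fin_two]; exact h.2
  obtain ⟨i, j, hij⟩ : ∃ i j, h i j ≠ 0 := by
    by_contra! H
    simp [H] at hdet
  obtain ⟨u, m, hm, n, hn⟩ := exists_eq_smul_of_mul_mem_range (φ := GaussianInt.toComplex)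
    (v := fun p : Fin 2 × Fin 2 => h p.1 p.2) (k := 1)
    (fun H => hij (congrFun H (i, j))) (mul_ne_zero two_ne_zero hij) (fun p => hmul _ _ _ _)
    (fun p => by simpa using hsq p.1 p.2)
  refine ⟨u, ?_, fun i j => ⟨_, ⟨m (i, j), rfl⟩, hm (i, j)⟩⟩
  have hu : IsUnit n := by
    refine IsUnit.of_mul_eq_one (m (0, 0) * m (1, 1) - m (0, 1) * m (1, 0)) ?_
    apply GaussianInt.toComplex_injective
    have h00 := hm (0, 0)
    have h01 := hm (0, 1)
    have h10 := hm (1, 0)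
    have h11 := hm (1, 1)
    simp only at h00 h01 h10 h11
    rw [h00, h01, h10, h11] at hdet
    simp only [map_mul, map_sub, map_one, hn]
    linear_combination hdet
  have := isUnit_gaussianInt_toComplex hu
  rw [hn, one_mul] at this
  rcases this with h | h
  · left; rw [← h]; ring
  · exact Or.inr h

end Gaussian

section ComplexGroups

open scoped Pointwise

/-- The matrix conjugating `SO(3, ℤ[i])` into the standard position relative to `SL(2, ℤ[i])`,
normalized to have determinant one. -/
def thetaConj (r : ℂ) (hr : r ^ 2 = -((1 - I) / 2)) : SL2C :=
  ⟨!![r, r * (1 + I); r, 0], by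
    rw [Matrix.det_fin_two_of]; linear_combination (-(1 + I)) * hr - I_sq / 2⟩

/-- The matrix `diag(ζ, ζ⁻¹)` for a square root `ζ` of `i`. -/
def zetaDiag (ζ : ℂ) (hζ : ζ ^ 2 = I) : SL2C :=
  ⟨!![ζ, 0; 0, -I * ζ], by
    rw [Matrix.det_fin_two_of]; linear_combination (-I) * hζ - I_sq⟩

theorem coe_thetaConj {r : ℂ} (hr : r ^ 2 = -((1 - I) / 2)) :
    (thetaConj r hr : Matrix (Fin 2) (Fin 2) ℂ) = !![r, r * (1 + I); r, 0] := rfl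

theorem coe_thetaConj_inv {r : ℂ} (hr : r ^ 2 = -((1 - I) / 2)) :
    (((thetaConj r hr)⁻¹ : SL2C) : Matrix (Fin 2) (Fin 2) ℂ) = !![0, -(r * (1 + I)); -r, r] := by
  have h := Matrix.SpecialLinearGroup.coe_inv (thetaConj r hr)
  rwa [coe_thetaConj, Matrix.adjugate_fin_two_of] at h

theorem coe_zetaDiag {ζ : ℂ} (hζ : ζ ^ 2 = I) :
    (zetaDiag ζ hζ : Matrix (Fin 2) (Fin 2) ℂ) = !![ζ, 0; 0, -I * ζ] := rfl

theorem coe_zetaDiag_inv {ζ : ℂ} (hζ : ζ ^ 2 = I) :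
    (((zetaDiag ζ hζ)⁻¹ : SL2C) : Matrix (Fin 2) (Fin 2) ℂ) = !![-I * ζ, -0; -0, ζ] := by
  have h := Matrix.SpecialLinearGroup.coe_inv (zetaDiag ζ hζ)
  rwa [coe_zetaDiag, Matrix.adjugate_fin_two_of] at h

theorem thetaConj_conj_mem_iff {r : ℂ} (hr : r ^ 2 = -((1 - I) / 2)) (h : SL2C) :
    thetaConj r hr * h * (thetaConj r hr)⁻¹ ∈ GammaSL ↔
      ∀ z ∈ [h 0 0 ^ 2, h 0 1 ^ 2, h 1 0 ^ 2, h 1 1 ^ 2, (1 - I) * (h 0 0 * h 0 1),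
        (1 + I) * (h 0 0 * h 1 0), (1 - I) * (h 0 1 * h 1 1), (1 + I) * (h 1 0 * h 1 1),
        h 0 0 * h 1 1 + h 0 1 * h 1 0], z ∈ GaussianInt.toComplex.range := by
  have hdet : h 0 0 * h 1 1 - h 0 1 * h 1 0 = 1 := by
    rw [← Matrix.det_fin_two]; exact h.2
  rw [← isGauss_cMat_conj_iff _ _ _ _ hdet, GammaSL, Set.mem_ofPred_eq]
  suffices H : ((thetaConj r hr * h * (thetaConj r hr)⁻¹ : SL2C) : Matrix (Fin 2) (Fin 2) ℂ) = _ by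
    rw [H]
  have hI := I_sq
  rw [Matrix.SpecialLinearGroup.coe_mul, Matrix.SpecialLinearGroup.coe_mul, coe_thetaConj,
    coe_thetaConj_inv]
  ext i j
  fin_cases i <;> fin_cases j <;>
    simp [Matrix.mul_apply, Matrix.vecMul, dotProduct, Fin.sum_univ_two] <;> grind

theorem thetaConj_conj_mem_of_mem_SL2ZiSL {r : ℂ} (hr : r ^ 2 = -((1 - I) / 2)) {h : SL2C}
    (hh : h ∈ SL2ZiSL) : thetaConj r hr * h * (thetaConj r hr)⁻¹ ∈ GammaSL := by
  have hG : ∀ i j, h i j ∈ GaussianInt.toComplex.range := fun i j =>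
    isGauss_iff_mem_range.1 (hh i j)
  rw [thetaConj_conj_mem_iff]
  simp only [List.forall_mem_cons, List.not_mem_nil, IsEmpty.forall_iff, implies_true, and_true]
  have hadd : 1 + I ∈ GaussianInt.toComplex.range := add_mem (one_mem _) I_mem_range_toComplex
  have hsub : 1 - I ∈ GaussianInt.toComplex.range := sub_mem (one_mem _) I_mem_range_toComplex
  have hmul : ∀ i j k l, h i j * h k l ∈ GaussianInt.toComplex.range := fun i j k l =>
    mul_mem (hG i j) (hG k l)
  exact ⟨pow_mem (hG _ _) 2, pow_mem (hG _ _) 2, pow_mem (hG _ _) 2, pow_mem (hG _ _) 2,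
    mul_mem hsub (hmul _ _ _ _), mul_mem hadd (hmul _ _ _ _), mul_mem hsub (hmul _ _ _ _),
    mul_mem hadd (hmul _ _ _ _), add_mem (hmul _ _ _ _) (hmul _ _ _ _)⟩

theorem thetaConj_conj_zetaDiag_mem {r ζ : ℂ} (hr : r ^ 2 = -((1 - I) / 2)) (hζ : ζ ^ 2 = I) :
    thetaConj r hr * zetaDiag ζ hζ * (thetaConj r hr)⁻¹ ∈ GammaSL := by
  rw [thetaConj_conj_mem_iff]
  have h : ζ * (I * ζ) = -1 := by linear_combination I * hζ + I_sq
  simp only [coe_zetaDiag, List.forall_mem_cons, List.not_mem_nil, IsEmpty.forall_iff,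
    implies_true, and_true]
  have h0 := zero_mem GaussianInt.toComplex.range
  have h1 := one_mem GaussianInt.toComplex.range
  have hI := I_mem_range_toComplex
  have hI' := neg_mem hI
  simp [mul_pow, hζ, h, -RingHom.mem_range, h0, h1, hI, hI']

theorem mem_or_mul_zetaDiag_inv_mem {r ζ : ℂ} (hr : r ^ 2 = -((1 - I) / 2)) (hζ : ζ ^ 2 = I)
    {h : SL2C} (hh : thetaConj r hr * h * (thetaConj r hr)⁻¹ ∈ GammaSL) :
    h ∈ SL2ZiSL ∨ h * (zetaDiag ζ hζ)⁻¹ ∈ SL2ZiSL := by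
  rw [thetaConj_conj_mem_iff] at hh
  simp only [List.forall_mem_cons, List.not_mem_nil, IsEmpty.forall_iff, implies_true,
    and_true] at hh
  obtain ⟨haa, hbb, hcc, hdd, hab, hac, hbd, hcd, he⟩ := hh
  have hdet : h 0 0 * h 1 1 - h 0 1 * h 1 0 = 1 := by
    rw [← Matrix.det_fin_two]; exact h.2
  have h1 : (1 + I) ∈ GaussianInt.toComplex.range := add_mem (one_mem _) I_mem_range_toComplex
  have h2 : (1 - I) ∈ GaussianInt.toComplex.range := sub_mem (one_mem _) I_mem_range_toComplex
  have hI := I_sq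
  have h0 : (2 : ℂ) ∈ GaussianInt.toComplex.range := ofNat_mem _ 2
  have hab := mul_mem h1 hab
  have hac := mul_mem h2 hac
  have hbd := mul_mem h1 hbd
  have hcd := mul_mem h2 hcd
  have had := add_mem he (one_mem _)
  have hbc := sub_mem he (one_mem _)
  have haa' := mul_mem h0 haa
  have hbb' := mul_mem h0 hbb
  have hcc' := mul_mem h0 hcc
  have hdd' := mul_mem h0 hdd
  obtain ⟨u, hu, hm⟩ := exists_scalar_of_gaussian_products h
    (by simpa [Fin.forall_fin_two] using ⟨⟨haa, hbb⟩, hcc, hdd⟩) (by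
      simp only [Fin.forall_fin_two]
      refine ⟨⟨⟨⟨?_, ?_⟩, ?_, ?_⟩, ⟨?_, ?_⟩, ?_, ?_⟩, ⟨⟨?_, ?_⟩, ?_, ?_⟩, ⟨?_, ?_⟩, ?_, ?_⟩ <;>
      first
      | (convert haa' using 1; grind)
      | (convert hbb' using 1; grind)
      | (convert hcc' using 1; grind)
      | (convert hdd' using 1; grind)
      | (convert hab using 1; grind)
      | (convert hac using 1; grind)
      | (convert hbd using 1; grind)
      | (convert hcd using 1; grind)
      | (convert had using 1; grind)
      | (convert hbc using 1; grind))
  rcases hu with hu | hu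
  · left
    have huG : u ∈ GaussianInt.toComplex.range := mem_range_toComplex_of_sq (by grind)
    intro i j
    obtain ⟨z, hz, hhz⟩ := hm i j
    exact isGauss_iff_mem_range.2 (hhz ▸ mul_mem huG hz)
  · right
    have huG : u * ζ ∈ GaussianInt.toComplex.range := mem_range_toComplex_of_sq (by grind)
    have hmul : ∀ i j, h i j * ζ ∈ GaussianInt.toComplex.range := fun i j => by
      obtain ⟨z, hz, hhz⟩ := hm i j
      rw [hhz, mul_right_comm]
      exact mul_mem huG hz
    intro i j
    rw [isGauss_iff_mem_range]
    have key : ∀ i, (h * (zetaDiag ζ hζ)⁻¹ : SL2C) i 0 = -(I * (h i 0 * ζ)) ∧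
        (h * (zetaDiag ζ hζ)⁻¹ : SL2C) i 1 = h i 1 * ζ := fun i => by
      rw [Matrix.SpecialLinearGroup.coe_mul, coe_zetaDiag_inv]
      simp [Matrix.mul_apply, Fin.sum_univ_two]
      ring
    fin_cases j
    · exact (key i).1 ▸ neg_mem (mul_mem I_mem_range_toComplex (hmul i 0))
    · exact (key i).2 ▸ hmul i 1

theorem zetaDiag_not_mem {ζ : ℂ} (hζ : ζ ^ 2 = I) : zetaDiag ζ hζ ∉ SL2ZiSL := by
  intro h
  obtain ⟨a, b, hab⟩ := h 0 0
  have : ζ = a + b * I := by simpa [zetaDiag] using hab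
  rw [this] at hζ
  have him := congrArg Complex.im hζ
  simp [pow_two] at him
  norm_cast at him
  rw [mul_comm b a] at him
  omega

theorem countable_subgroup_of_entries {F : Type*} [CommRing F]
    {H : Subgroup (Matrix.SpecialLinearGroup (Fin 2) F)} {s : Set F} (hs : s.Countable)
    (h : ∀ g ∈ H, ∀ i j, g i j ∈ s) : Countable H := by
  have := hs.to_subtype
  refine Function.Injective.countable
    (f := fun (g : H) (i j : Fin 2) => (⟨(g : Matrix.SpecialLinearGroup (Fin 2) F) i j,
      h g.1 g.2 i j⟩ : s)) fun g g' hgg =>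
    Subtype.ext (Matrix.SpecialLinearGroup.ext _ _ fun i j => ?_)
  exact congrArg Subtype.val (congrFun (congrFun hgg i) j)

theorem existsUnique_bool {p : Bool → Prop} (h : p false ∨ p true) (h' : ¬(p false ∧ p true)) :
    ∃! b, p b := by
  rcases h with h | h
  · exact ⟨false, h, fun b hb => by cases b <;> tauto⟩
  · exact ⟨true, h, fun b hb => by cases b <;> tauto⟩

theorem measure_SL2ZiSL_eq (μ : Measure SL2C) [μ.IsHaarMeasure]
    (HΓ HZi : Subgroup SL2C) (hHΓ : (HΓ : Set SL2C) = GammaSL)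
    (hHZi : (HZi : Set SL2C) = SL2ZiSL) (S S₀ : Set SL2C)
    (hS : IsFundamentalDomain HΓ S μ) (hS₀ : IsFundamentalDomain HZi S₀ μ) :
    μ S₀ = 2 * μ S := by
  obtain ⟨r, hr⟩ := IsAlgClosed.exists_pow_nat_eq (-((1 - I) / 2)) two_pos
  obtain ⟨ζ, hζ⟩ := IsAlgClosed.exists_pow_nat_eq I two_pos
  have hΓ : ∀ g, g ∈ HΓ ↔ g ∈ GammaSL := fun g => by rw [← hHΓ]; rfl
  have hZi : ∀ g, g ∈ HZi ↔ g ∈ SL2ZiSL := fun g => by rw [← hHZi]; rfl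
  have hE : ∀ h, h ∈ HΓ.map (MulAut.conj (thetaConj r hr)⁻¹).toMonoidHom ↔
      thetaConj r hr * h * (thetaConj r hr)⁻¹ ∈ GammaSL := fun h => by
    rw [Subgroup.mem_map_equiv, hΓ]
    simp
  have := countable_subgroup_of_entries (H := HZi) (s := GaussianInt.toComplex.range)
    (by
      have : Countable GaussianInt := Function.Injective.countable
        (f := fun z : GaussianInt => (z.re, z.im)) fun x y h => Zsqrtd.ext
          (congrArg Prod.fst h) (congrArg Prod.snd h)
      exact Set.countable_range _)
    fun g hg i j => isGauss_iff_mem_range.1 ((hZi g).1 hg i j)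
  have key := measure_eq_card_mul_of_cosets (isFundamentalDomain_smul_conj hS (thetaConj r hr)⁻¹)
    hS₀ (fun h hh => (hE h).2 (thetaConj_conj_mem_of_mem_SL2ZiSL hr ((hZi h).1 hh)))
    (fun b : Bool => if b then zetaDiag ζ hζ else 1) (by
      intro b
      cases b
      · exact one_mem _
      · exact (hE _).2 (thetaConj_conj_zetaDiag_mem hr hζ)) (by
      intro h hh
      refine existsUnique_bool ?_ ?_
      · simpa [hZi] using mem_or_mul_zetaDiag_inv_mem hr hζ ((hE h).1 hh)
      · rintro ⟨h1, h2⟩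
        refine zetaDiag_not_mem hζ ((hZi _).1 ?_)
        simpa using mul_mem (inv_mem h2) h1)
  rw [key, measure_smul]
  simp

end ComplexGroups

section RealGroups

open scoped Pointwise

theorem isGauss_ofReal_iff {x : ℝ} : IsGauss x ↔ x ∈ (Int.castRingHom ℝ).range := by
  constructor
  · rintro ⟨a, b, h⟩
    exact ⟨a, by simpa using (congrArg Complex.re h).symm⟩
  · rintro ⟨n, rfl⟩
    exact ⟨n, 0, by simp⟩

theorem isGauss_I_mul_ofReal_iff {x : ℝ} : IsGauss (I * x) ↔ x ∈ (Int.castRingHom ℝ).range := by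
  rw [← isGauss_ofReal_iff, isGauss_iff_mem_range, isGauss_iff_mem_range,
    I_mul_mem_range_toComplex_iff]

theorem mem_GammaRSL_iff (g : SL2R) : g ∈ GammaRSL ↔
    ∀ x ∈ [(g 0 0 ^ 2 - g 1 0 ^ 2 + g 1 1 ^ 2 - g 0 1 ^ 2) / 2,
      (g 0 0 ^ 2 - g 1 0 ^ 2 + g 0 1 ^ 2 - g 1 1 ^ 2) / 2,
      g 1 0 * g 1 1 - g 0 0 * g 0 1,
      (g 0 1 ^ 2 + g 1 1 ^ 2 - g 0 0 ^ 2 - g 1 0 ^ 2) / 2,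
      (g 0 0 ^ 2 + g 1 0 ^ 2 + g 0 1 ^ 2 + g 1 1 ^ 2) / 2,
      g 0 0 * g 0 1 + g 1 0 * g 1 1,
      -(g 0 0 * g 1 0) + g 0 1 * g 1 1,
      g 0 0 * g 1 0 + g 0 1 * g 1 1,
      g 0 0 * g 1 1 + g 0 1 * g 1 0], x ∈ (Int.castRingHom ℝ).range := by
  simp only [GammaRSL, CMat, Set.mem_ofPred_eq, Matrix.map_apply, mul_div_assoc]
  norm_cast
  simp only [Fin.forall_fin_succ, Matrix.of_apply, Matrix.cons_val', Matrix.cons_val_zero,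
    Matrix.cons_val_succ, Matrix.cons_val_fin_one,
    IsEmpty.forall_iff, and_true, Fin.isValue, isGauss_ofReal_iff, isGauss_I_mul_ofReal_iff,
    List.forall_mem_cons, List.not_mem_nil, implies_true, and_assoc]

theorem mem_GammaRSL_iff_even {g : SL2R} {a b c d : ℤ} (ha : g 0 0 = a) (hb : g 0 1 = b)
    (hc : g 1 0 = c) (hd : g 1 1 = d) : g ∈ GammaRSL ↔ Even (a + b + c + d) := by
  rw [mem_GammaRSL_iff, ha, hb, hc, hd]
  simp only [List.forall_mem_cons, List.not_mem_nil, IsEmpty.forall_iff, implies_true, and_true]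
  constructor
  · rintro ⟨-, -, -, -, ⟨n, hn⟩, -⟩
    have h : a ^ 2 + c ^ 2 + b ^ 2 + d ^ 2 = 2 * n := by
      rw [eq_intCast] at hn
      have : (a : ℝ) ^ 2 + c ^ 2 + b ^ 2 + d ^ 2 = 2 * n := by linarith
      exact_mod_cast this
    have h2 : Even (a ^ 2 + c ^ 2 + b ^ 2 + d ^ 2) := h ▸ even_two_mul n
    simp only [Int.even_add, Int.even_pow' two_ne_zero] at h2 ⊢
    tauto
  · rintro ⟨k, hk⟩
    obtain rfl : a = 2 * k - b - c - d := by omega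
    refine ⟨⟨2 * k ^ 2 - 2 * k * (b + c + d) + b * c + b * d + c * d + d ^ 2, ?_⟩,
      ⟨2 * k ^ 2 - 2 * k * (b + c + d) + b * c + b * d + c * d + b ^ 2, ?_⟩,
      ⟨c * d - (2 * k - b - c - d) * b, ?_⟩,
      ⟨-(2 * k ^ 2 - 2 * k * (b + c + d) + b * c + b * d + c * d + c ^ 2), ?_⟩,
      ⟨2 * k ^ 2 - 2 * k * (b + c + d) + b * c + b * d + c * d + b ^ 2 + c ^ 2 + d ^ 2, ?_⟩,
      ⟨(2 * k - b - c - d) * b + c * d, ?_⟩, ⟨-((2 * k - b - c - d) * c) + b * d, ?_⟩,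
      ⟨(2 * k - b - c - d) * c + b * d, ?_⟩, ⟨(2 * k - b - c - d) * d + b * c, ?_⟩⟩ <;>
    rw [eq_intCast] <;> push_cast <;> ring

/-- Representatives of the right cosets of `Γ'_ℝ ∩ SL(2, ℤ)` in `SL(2, ℤ)`. -/
def thetaRep : Fin 3 → SL2R :=
  ![1, ⟨!![1, 1; 0, 1], by simp⟩, ⟨!![1, 0; 1, 1], by simp⟩]

/-- Rotation by an eighth of a turn, in terms of a square root of one half. -/
def eighthTurn (w : ℝ) (hw : w ^ 2 = 1 / 2) : SL2R :=
  ⟨!![w, w; -w, w], by rw [Matrix.det_fin_two_of]; linear_combination 2 * hw⟩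

theorem eighthTurn_mem {w : ℝ} (hw : w ^ 2 = 1 / 2) : eighthTurn w hw ∈ GammaRSL := by
  have hw' : w * w = 1 / 2 := by rw [← pow_two, hw]
  have h0 := zero_mem (Int.castRingHom ℝ).range
  have h1 := one_mem (Int.castRingHom ℝ).range
  have h1' := neg_mem h1
  rw [mem_GammaRSL_iff]
  norm_num [eighthTurn, hw, hw', -RingHom.mem_range, h0, h1, h1']

theorem eighthTurn_not_mem {w : ℝ} (hw : w ^ 2 = 1 / 2) : eighthTurn w hw ∉ SL2ZSL := by
  intro h
  obtain ⟨n, hn⟩ := h 0 0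
  have hn : w = n := by simpa [eighthTurn] using hn
  rw [hn] at hw
  have : 2 * n ^ 2 = 1 := by
    have : 2 * (n : ℝ) ^ 2 = 1 := by linarith
    exact_mod_cast this
  omega

theorem even_add_of_sq {x y z t p q : ℤ} (hxyzt : x ^ 2 + z ^ 2 + y ^ 2 + t ^ 2 = 4 * p)
    (hxz : x ^ 2 - z ^ 2 + (y ^ 2 - t ^ 2) = 4 * q) : Even (x + y) := by
  have h : x ^ 2 + y ^ 2 = 2 * (p + q) := by linarith
  have h2 : Even (x ^ 2 + y ^ 2) := h ▸ even_two_mul _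
  simpa only [Int.even_add, Int.even_pow' two_ne_zero] using h2

theorem mem_or_mul_eighthTurn_inv_mem {w : ℝ} (hw : w ^ 2 = 1 / 2) {h : SL2R}
    (hh : h ∈ GammaRSL) : h ∈ SL2ZSL ∨ h * (eighthTurn w hw)⁻¹ ∈ SL2ZSL := by
  rw [mem_GammaRSL_iff] at hh
  simp only [List.forall_mem_cons, List.not_mem_nil, IsEmpty.forall_iff, implies_true,
    and_true] at hh
  obtain ⟨h1, h2, h3, h4, h5, h6, h7, h8, h9⟩ := hh
  have hdet : h 0 0 * h 1 1 - h 0 1 * h 1 0 = 1 := by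
    rw [← Matrix.det_fin_two]; exact h.2
  have hone := one_mem (Int.castRingHom ℝ).range
  have haa := add_mem (sub_mem h5 h4) (add_mem h1 h2)
  have hbb := add_mem (add_mem h5 h4) (sub_mem h2 h1)
  have hcc := sub_mem (sub_mem h5 h4) (add_mem h1 h2)
  have hdd := add_mem (add_mem h5 h4) (sub_mem h1 h2)
  have hab := sub_mem h6 h3
  have hcd := add_mem h6 h3
  have hac := sub_mem h8 h7
  have hbd := add_mem h8 h7
  have had := add_mem h9 hone
  have hbc := sub_mem h9 hone
  obtain ⟨i, j, hij⟩ : ∃ i j, h i j ≠ 0 := by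
    by_contra! H
    simp [H] at hdet
  have hmul : ∀ i j k l, 2 * h i j * h k l ∈ (Int.castRingHom ℝ).range := by
    simp only [Fin.forall_fin_two]
    refine ⟨⟨⟨⟨?_, ?_⟩, ?_, ?_⟩, ⟨?_, ?_⟩, ?_, ?_⟩, ⟨⟨?_, ?_⟩, ?_, ?_⟩, ⟨?_, ?_⟩, ?_, ?_⟩ <;>
      first
      | (convert haa using 1; grind)
      | (convert hbb using 1; grind)
      | (convert hcc using 1; grind)
      | (convert hdd using 1; grind)
      | (convert hab using 1; grind)
      | (convert hac using 1; grind)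
      | (convert hbd using 1; grind)
      | (convert hcd using 1; grind)
      | (convert had using 1; grind)
      | (convert hbc using 1; grind)
  obtain ⟨u, m, hm, n, hn⟩ := exists_eq_smul_of_mul_mem_range (φ := Int.castRingHom ℝ)
    (v := fun p : Fin 2 × Fin 2 => h p.1 p.2) (k := 2)
    (fun H => hij (congrFun H (i, j))) (mul_ne_zero two_ne_zero hij) (fun p => hmul _ _ _ _)
    (fun p => by simpa only [pow_two, ← mul_assoc] using hmul p.1 p.2 p.1 p.2)
  simp only [eq_intCast] at hm hn
  have h00 : h 0 0 = u * m (0, 0) := hm (0, 0)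
  have h01 : h 0 1 = u * m (0, 1) := hm (0, 1)
  have h10 : h 1 0 = u * m (1, 0) := hm (1, 0)
  have h11 : h 1 1 = u * m (1, 1) := hm (1, 1)
  have hndet : n * (m (0, 0) * m (1, 1) - m (0, 1) * m (1, 0)) = 2 := by
    have : (n : ℝ) * (m (0, 0) * m (1, 1) - m (0, 1) * m (1, 0)) = 2 := by
      rw [hn]
      rw [h00, h01, h10, h11] at hdet
      linear_combination 2 * hdet
    exact_mod_cast this
  have hn0 : 0 ≤ n := by
    have : (0 : ℝ) ≤ n := hn ▸ by positivity
    exact_mod_cast this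
  have hn2 : n ≤ 2 := Int.le_of_dvd two_pos ⟨_, hndet.symm⟩
  obtain rfl | rfl | rfl : n = 0 ∨ n = 1 ∨ n = 2 := by omega
  · simp at hndet
  · right
    have hu : u ^ 2 = 1 / 2 := by push_cast at hn; linarith
    have huw : u = w ∨ u = -w := by rw [← sq_eq_sq_iff_eq_or_eq_neg, hu, hw]
    have huw2 : ∃ s : ℤ, u * w = s / 2 := by
      rcases huw with rfl | rfl
      · exact ⟨1, by push_cast; linarith⟩
      · exact ⟨-1, by push_cast; linarith⟩
    obtain ⟨s, hs⟩ := huw2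
    rw [h00, h01, h10, h11] at h5 h2
    obtain ⟨p, hp⟩ := h5
    obtain ⟨q, hq⟩ := h2
    rw [eq_intCast] at hp hq
    have hp' : m (0, 0) ^ 2 + m (1, 0) ^ 2 + m (0, 1) ^ 2 + m (1, 1) ^ 2 = 4 * p := by
      have : (m (0, 0) : ℝ) ^ 2 + m (1, 0) ^ 2 + m (0, 1) ^ 2 + m (1, 1) ^ 2 = 4 * p := by
        rw [hp]; linear_combination (-2 * ((m (0, 0) : ℝ) ^ 2 + m (1, 0) ^ 2 + m (0, 1) ^ 2
          + m (1, 1) ^ 2)) * hu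
      exact_mod_cast this
    have hq' : m (0, 0) ^ 2 - m (1, 0) ^ 2 + (m (0, 1) ^ 2 - m (1, 1) ^ 2) = 4 * q := by
      have : (m (0, 0) : ℝ) ^ 2 - m (1, 0) ^ 2 + (m (0, 1) ^ 2 - m (1, 1) ^ 2) = 4 * q := by
        rw [hq]; linear_combination (-2 * ((m (0, 0) : ℝ) ^ 2 - m (1, 0) ^ 2 + m (0, 1) ^ 2
          - m (1, 1) ^ 2)) * hu
      exact_mod_cast this
    have he : ∀ i, Even (m (i, 0) + m (i, 1)) := by
      rw [Fin.forall_fin_two]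
      exact ⟨even_add_of_sq hp' hq', even_add_of_sq (q := -q) (z := m (0, 0)) (t := m (0, 1))
        (by rw [← hp']; ring) (by linear_combination -hq')⟩
    have hinv : (((eighthTurn w hw)⁻¹ : SL2R) : Matrix (Fin 2) (Fin 2) ℝ) = !![w, -w; - -w, w] := by
      rw [Matrix.SpecialLinearGroup.coe_inv]
      exact Matrix.adjugate_fin_two_of _ _ _ _
    intro i j
    obtain ⟨k, hk⟩ := he i
    have hkR : (m (i, 0) : ℝ) + m (i, 1) = k + k := by exact_mod_cast hk
    have hi0 : h i 0 = u * m (i, 0) := hm (i, 0)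
    have hi1 : h i 1 = u * m (i, 1) := hm (i, 1)
    rw [Matrix.SpecialLinearGroup.coe_mul, hinv, Matrix.mul_apply, Fin.sum_univ_two, hi0, hi1]
    fin_cases j
    · refine ⟨s * k, ?_⟩
      simp
      linear_combination ((m (i, 0) : ℝ) + m (i, 1)) * hs + (s / 2 : ℝ) * hkR
    · refine ⟨s * (k - m (i, 0)), ?_⟩
      simp
      linear_combination ((m (i, 1) : ℝ) - m (i, 0)) * hs + (s / 2 : ℝ) * hkR
  · left
    have hu : u ^ 2 = 1 := by push_cast at hn; linarith
    intro i j
    rw [show h i j = u * m (i, j) from hm (i, j)]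
    rcases sq_eq_one_iff.1 hu with rfl | rfl
    · exact ⟨m (i, j), by simp⟩
    · exact ⟨-m (i, j), by simp⟩

theorem existsUnique_fin_three {p : Fin 3 → Prop}
    (h : (p 0 ∧ ¬p 1 ∧ ¬p 2) ∨ (¬p 0 ∧ p 1 ∧ ¬p 2) ∨ (¬p 0 ∧ ¬p 1 ∧ p 2)) : ∃! i, p i := by
  rcases h with h | h | h
  · exact ⟨0, h.1, fun i hi => by fin_cases i <;> tauto⟩
  · exact ⟨1, h.2.1, fun i hi => by fin_cases i <;> tauto⟩
  · exact ⟨2, h.2.2, fun i hi => by fin_cases i <;> tauto⟩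

theorem thetaRep_mem (i : Fin 3) : thetaRep i ∈ SL2ZSL := by
  intro j k
  fin_cases i <;> fin_cases j <;> fin_cases k <;> simp [thetaRep] <;>
    first | exact ⟨0, Int.cast_zero.symm⟩ | exact ⟨1, Int.cast_one.symm⟩

theorem existsUnique_mul_thetaRep_inv_mem {h : SL2R} (hh : h ∈ SL2ZSL) :
    ∃! i, h * (thetaRep i)⁻¹ ∈ GammaRSL := by
  choose m hm using hh
  have hdet : m 0 0 * m 1 1 - m 0 1 * m 1 0 = 1 := by
    have : h 0 0 * h 1 1 - h 0 1 * h 1 0 = 1 := by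
      rw [← Matrix.det_fin_two]; exact h.2
    simp only [hm] at this
    exact_mod_cast this
  have hpar : ¬Even (m 0 0 * m 1 1 - m 0 1 * m 1 0) := by rw [hdet]; decide
  have hinv1 : (((thetaRep 1)⁻¹ : SL2R) : Matrix (Fin 2) (Fin 2) ℝ) = !![1, -1; -0, 1] := by
    rw [Matrix.SpecialLinearGroup.coe_inv]
    exact Matrix.adjugate_fin_two_of _ _ _ _
  have hinv2 : (((thetaRep 2)⁻¹ : SL2R) : Matrix (Fin 2) (Fin 2) ℝ) = !![1, -0; -1, 1] := by
    rw [Matrix.SpecialLinearGroup.coe_inv]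
    exact Matrix.adjugate_fin_two_of _ _ _ _
  have h0 : h * (thetaRep 0)⁻¹ ∈ GammaRSL ↔ Even (m 0 0 + m 0 1 + m 1 0 + m 1 1) := by
    rw [show thetaRep 0 = 1 from rfl, inv_one, mul_one]
    exact mem_GammaRSL_iff_even (hm 0 0) (hm 0 1) (hm 1 0) (hm 1 1)
  have h1 : h * (thetaRep 1)⁻¹ ∈ GammaRSL ↔
      Even (m 0 0 + (m 0 1 - m 0 0) + m 1 0 + (m 1 1 - m 1 0)) := by
    apply mem_GammaRSL_iff_even <;>
      rw [Matrix.SpecialLinearGroup.coe_mul, hinv1, Matrix.mul_apply, Fin.sum_univ_two, hm, hm] <;>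
      simp <;> ring
  have h2 : h * (thetaRep 2)⁻¹ ∈ GammaRSL ↔
      Even ((m 0 0 - m 0 1) + m 0 1 + (m 1 0 - m 1 1) + m 1 1) := by
    apply mem_GammaRSL_iff_even <;>
      rw [Matrix.SpecialLinearGroup.coe_mul, hinv2, Matrix.mul_apply, Fin.sum_univ_two, hm, hm] <;>
      simp <;> ring
  apply existsUnique_fin_three
  rw [h0, h1, h2]
  simp only [Int.even_add, Int.even_sub, Int.even_mul] at hpar ⊢
  by_cases ha : Even (m 0 0) <;> by_cases hb : Even (m 0 1) <;>
    by_cases hc : Even (m 1 0) <;> by_cases hd : Even (m 1 1) <;>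
    simp only [ha, hb, hc, hd] at hpar ⊢ <;> simp at hpar ⊢

theorem two_mul_measure_GammaRSL_eq (ν : Measure SL2R) [ν.IsHaarMeasure]
    (HΓR HZ : Subgroup SL2R) (hHΓR : (HΓR : Set SL2R) = GammaRSL)
    (hHZ : (HZ : Set SL2R) = SL2ZSL) (S' S₀' : Set SL2R)
    (hS' : IsFundamentalDomain HΓR S' ν) (hS₀' : IsFundamentalDomain HZ S₀' ν) :
    2 * ν S' = 3 * ν S₀' := by
  have hΓ : ∀ g, g ∈ HΓR ↔ g ∈ GammaRSL := fun g => by rw [← hHΓR]; rfl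
  have hZ : ∀ g, g ∈ HZ ↔ g ∈ SL2ZSL := fun g => by rw [← hHZ]; rfl
  obtain ⟨w, hw⟩ : ∃ w : ℝ, w ^ 2 = 1 / 2 := ⟨√(1 / 2), Real.sq_sqrt (by norm_num)⟩
  have : Countable (HΓR ⊓ HZ : Subgroup SL2R) :=
    countable_subgroup_of_entries (s := Set.range ((↑) : ℤ → ℝ)) (Set.countable_range _)
      fun g hg i j => by
        obtain ⟨n, hn⟩ := (hZ g).1 hg.2 i j
        exact ⟨n, hn.symm⟩
  let r : Bool → SL2R := fun b => if b then eighthTurn w hw else 1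
  have hr : ∀ b, r b ∈ HΓR := by
    rintro (_ | _)
    · exact one_mem _
    · exact (hΓ _).2 (eighthTurn_mem hw)
  have hu : ∀ h ∈ HΓR, ∃! b, h * (r b)⁻¹ ∈ HΓR ⊓ HZ := by
    intro h hh
    have hmem : ∀ b, h * (r b)⁻¹ ∈ HΓR ⊓ HZ ↔ h * (r b)⁻¹ ∈ HZ := fun b =>
      Subgroup.mem_inf.trans (and_iff_right (mul_mem hh (inv_mem (hr b))))
    simp only [hmem]
    refine existsUnique_bool ?_ ?_
    · simpa [hZ, r] using mem_or_mul_eighthTurn_inv_mem hw ((hΓ h).1 hh)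
    · rintro ⟨h1, h2⟩
      refine eighthTurn_not_mem hw ((hZ _).1 ?_)
      simpa [r] using mul_mem (inv_mem h2) h1
  have hu3 : ∀ h ∈ HZ, ∃! i, h * (thetaRep i)⁻¹ ∈ HΓR ⊓ HZ := by
    intro h hh
    have hmem : ∀ i, h * (thetaRep i)⁻¹ ∈ HΓR ⊓ HZ ↔ h * (thetaRep i)⁻¹ ∈ GammaRSL := fun i => by
      rw [← hΓ]
      exact Subgroup.mem_inf.trans (and_iff_left (mul_mem hh (inv_mem ((hZ _).2 (thetaRep_mem i)))))
    simp only [hmem]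
    exact existsUnique_mul_thetaRep_inv_mem ((hZ h).1 hh)
  have key := measure_eq_card_mul_of_cosets hS₀'
    (isFundamentalDomain_iUnion_smul hS' inf_le_left r hr hu) inf_le_right thetaRep
    (fun i => (hZ _).2 (thetaRep_mem i)) hu3
  rw [measure_iUnion_smul hS' r hr hu] at key
  simpa using key

end RealGroups

/-- Covolume ratios: for a left Haar measure `μ` on `SL(2,ℂ)`, a fundamental domain of
`Γ'` has measure `1/2` that of a fundamental domain of `SL(2,ℤ[i])`; for a left Haar
measure `ν` on `SL(2,ℝ)`, a fundamental domain of `Γ'_ℝ` has measure `3/2` that of a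
fundamental domain of `SL(2,ℤ)`. -/
theorem stmt19 (μ : Measure SL2C) [μ.IsHaarMeasure]
    (ν : Measure SL2R) [ν.IsHaarMeasure]
    (HΓ HZi : Subgroup SL2C) (hHΓ : (HΓ : Set SL2C) = GammaSL)
    (hHZi : (HZi : Set SL2C) = SL2ZiSL)
    (S S₀ : Set SL2C)
    (hS : IsFundamentalDomain HΓ S μ) (hS₀ : IsFundamentalDomain HZi S₀ μ)
    (HΓR HZ : Subgroup SL2R) (hHΓR : (HΓR : Set SL2R) = GammaRSL)
    (hHZ : (HZ : Set SL2R) = SL2ZSL)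
    (S' S₀' : Set SL2R)
    (hS' : IsFundamentalDomain HΓR S' ν) (hS₀' : IsFundamentalDomain HZ S₀' ν) :
    μ S = (1 / 2 : ENNReal) * μ S₀ ∧ ν S' = (3 / 2 : ENNReal) * ν S₀' := by
  constructor
  · rw [measure_SL2ZiSL_eq μ HΓ HZi hHΓ hHZi S S₀ hS hS₀, ← mul_assoc, one_div,
      ENNReal.inv_mul_cancel two_ne_zero ENNReal.ofNat_ne_top, one_mul]
  · rw [div_eq_mul_inv, mul_right_comm,
      ← two_mul_measure_GammaRSL_eq ν HΓR HZ hHΓR hHZ S' S₀' hS' hS₀', mul_comm, ← mul_assoc,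
      ENNReal.inv_mul_cancel two_ne_zero ENNReal.ofNat_ne_top, one_mul]
end
end
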